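/- Let R be a commutative ring which is an algebra over ℚ, and let r ≥ 0 be an integer. Let the group ℤ^r act R-linearly on the multivariate polynomial ring R[T₁, …, T_r] by letting the j-th standard generator act as the R-algebra automorphism sending T_j to T_j + 1 and T_i to T_i for i ≠ j. Then: (1) the invariants of this representation of ℤ^r on R[T₁,…,T_r] are exactly the constant polynomials R; and (2) the group cohomology H^m(ℤ^r, R[T₁,…,T_r]) of this representation vanishes for every integer m ≥ 1. -/

import Mathlib

open CategoryTheory Limits Abelian MvPolynomial

theorem Polynomial.eq_C_of_comp_X_add_one_eq {B : Type*} [CommRing B] [Algebra ℚ B]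
    {q : Polynomial B} (hq : q.comp (Polynomial.X + 1) = q) : q = Polynomial.C (q.coeff 0) := by
  by_contra hne
  have hd : q.natDegree ≠ 0 := fun h => hne (Polynomial.eq_C_of_natDegree_eq_zero h)
  have hΔ : fwdDiff (1 : B) q.eval = 0 := by
    funext x
    have := congrArg (Polynomial.eval x) hq
    simp only [Polynomial.eval_comp, Polynomial.eval_add, Polynomial.eval_X,
      Polynomial.eval_one] at this
    simp [fwdDiff, this]
  have h0 : (fwdDiff (1 : B))^[q.natDegree] q.eval = 0 := by
    obtain ⟨d, hd'⟩ := Nat.exists_eq_succ_of_ne_zero hd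
    rw [hd', Function.iterate_succ_apply, hΔ]
    exact Function.iterate_fixed (by funext x; simp [fwdDiff]) d
  rw [Polynomial.fwdDiff_iter_degree_eq_factorial] at h0
  have h1 : q.leadingCoeff * (q.natDegree.factorial : B) = 0 := by
    simpa using congrFun h0 0
  have hu : IsUnit (q.natDegree.factorial : B) := by
    have : IsUnit ((q.natDegree.factorial : ℕ) : ℚ) :=
      (Nat.cast_ne_zero.mpr (Nat.factorial_ne_zero _)).isUnit
    simpa using this.map (algebraMap ℚ B)
  have h2 := (hu.mul_left_eq_zero).mp h1
  rw [Polynomial.leadingCoeff_eq_zero] at h2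
  exact hd (by simp [h2])

theorem Polynomial.exists_comp_X_add_one_eq_add_X_pow (B : Type*) [CommRing B] [Algebra ℚ B]
    (k : ℕ) : ∃ q : Polynomial B, q.comp (Polynomial.X + 1) = q + Polynomial.X ^ k := by
  let b : Polynomial ℚ := Polynomial.C ((k + 1 : ℚ)⁻¹) * Polynomial.bernoulli (k + 1)
  have hb : b.comp (Polynomial.X + 1) = b + Polynomial.X ^ k := by
    have hk : (k + 1 : ℚ) ≠ 0 := by positivity
    simp only [b, Polynomial.mul_comp, Polynomial.C_comp]
    rw [add_comm Polynomial.X, Polynomial.bernoulli_comp_one_add_X, mul_add,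
      Nat.add_sub_cancel, nsmul_eq_mul, ← mul_assoc, ← Polynomial.C_eq_natCast,
      ← Polynomial.C_mul]
    simp [hk]
  refine ⟨b.map (algebraMap ℚ B), ?_⟩
  have := congrArg (Polynomial.map (algebraMap ℚ B)) hb
  simpa [Polynomial.map_comp] using this

namespace MvPolynomial

variable {σ R : Type*} [DecidableEq σ] [CommRing R]

/-- The algebra endomorphism of `R[T_i : i ∈ σ]` sending `T_j` to `T_j + 1` and fixing the
other variables. -/
noncomputable def shift (R : Type*) [CommRing R] (j : σ) : MvPolynomial σ R →ₐ[R] MvPolynomial σ R :=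
  aeval fun i => X i + if i = j then 1 else 0

theorem shift_eq_self_of_mem_supported {j : σ} {s : Set σ} (hj : j ∉ s) {p : MvPolynomial σ R}
    (hp : p ∈ supported R s) : shift R j p = p := by
  have h : supported R s ≤ AlgHom.equalizer (shift R j) (AlgHom.id R _) := by
    rw [supported, Algebra.adjoin_le_iff]
    rintro _ ⟨i, hi, rfl⟩
    have : i ≠ j := fun h => hj (h ▸ hi)
    simp [shift, this]
  exact h hp

theorem notMem_vars_of_shift_eq_self [Algebra ℚ R] {j : σ} {p : MvPolynomial σ R}
    (hp : shift R j p = p) : j ∉ p.vars := by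
  let φ : MvPolynomial σ R →ₐ[R] Polynomial (MvPolynomial σ R) :=
    aeval fun i => if i = j then Polynomial.X else Polynomial.C (X i)
  let τ : Polynomial (MvPolynomial σ R) →ₐ[R] Polynomial (MvPolynomial σ R) :=
    (Polynomial.aeval (Polynomial.X + 1 : Polynomial (MvPolynomial σ R))).restrictScalars R
  have hτ : τ.comp φ = φ.comp (shift R j) := by
    ext1 i
    by_cases h : i = j <;> simp [φ, τ, shift, h]
  have hq : (φ p).comp (Polynomial.X + 1) = φ p := by
    have := DFunLike.congr_fun hτ p
    simp only [AlgHom.comp_apply, hp] at this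
    simpa [τ, Polynomial.comp_eq_aeval] using this
  have hev : ∀ a : MvPolynomial σ R, Polynomial.eval a (φ p) =
      bind₁ (fun i => if i = j then a else X i) p := by
    intro a
    have : ((Polynomial.aeval a).restrictScalars R).comp φ =
        bind₁ (fun i => if i = j then a else X i) := by
      ext1 i
      by_cases h : i = j <;> simp [φ, h]
    simpa [Polynomial.coe_aeval_eq_eval] using DFunLike.congr_fun this p
  have hX : bind₁ (fun i => if i = j then X j else X i) p = p := by
    have : (fun i => if i = j then X j else X i : σ → MvPolynomial σ R) = X := by
      funext i; by_cases h : i = j <;> simp [h]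
    rw [this, bind₁_X_left, AlgHom.id_apply]
  have h0 : p = bind₁ (fun i => if i = j then 0 else X i) p := by
    rw [← hev, Polynomial.eq_C_of_comp_X_add_one_eq hq, Polynomial.eval_C,
      ← Polynomial.eval_C (x := X j) (a := (φ p).coeff 0),
      ← Polynomial.eq_C_of_comp_X_add_one_eq hq, hev, hX]
  intro hj
  cases subsingleton_or_nontrivial R
  · simp [Subsingleton.elim p 0] at hj
  rw [h0] at hj
  obtain ⟨i, -, hi⟩ := Finset.mem_biUnion.mp (vars_bind₁ _ _ hj)
  by_cases h : i = j
  · simp [h] at hi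
  · rw [if_neg h] at hi
    exact h (by simpa using hi : j = i).symm

theorem mem_supported_compl_iff_shift_eq_self [Algebra ℚ R] {s : Set σ} {p : MvPolynomial σ R} :
    p ∈ supported R sᶜ ↔ ∀ j ∈ s, shift R j p = p := by
  refine ⟨fun hp j hj => shift_eq_self_of_mem_supported (by simpa using hj) hp, fun hp => ?_⟩
  rw [mem_supported]
  exact fun j hj hjs => notMem_vars_of_shift_eq_self (hp j hjs) hj

theorem exists_shift_sub_self_eq [Algebra ℚ R] {s : Set σ} {a : σ} (ha : a ∈ s)
    {p : MvPolynomial σ R} (hp : p ∈ supported R s) :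
    ∃ q ∈ supported R s, shift R a q - q = p := by
  choose S hS using Polynomial.exists_comp_X_add_one_eq_add_X_pow R
  have hSmem (k : ℕ) : Polynomial.aeval (X a : MvPolynomial σ R) (S k) ∈ supported R s :=
    Algebra.adjoin_mono (by simpa using ⟨a, ha, rfl⟩) (Polynomial.aeval_mem_adjoin_singleton R _)
  have hshift (k : ℕ) : shift R a (Polynomial.aeval (X a) (S k)) =
      Polynomial.aeval (X a) (S k) + X a ^ k := by
    rw [← Polynomial.aeval_algHom_apply]
    have := congrArg (Polynomial.aeval (X a : MvPolynomial σ R)) (hS k)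
    simpa [shift, Polynomial.aeval_comp] using this
  have hmono {t : Set σ} {m : σ →₀ ℕ} (c : R) (hm : ∀ i ∈ m.support, i ∈ t) :
      monomial m c ∈ supported R t := by
    rw [mem_supported]
    intro i hi
    obtain ⟨d, hd, hid⟩ := (mem_vars_iff_mem_support i).mp hi
    rw [Finset.mem_singleton.mp (support_monomial_subset hd)] at hid
    exact hm i hid
  refine ⟨∑ m ∈ p.support, monomial (m.erase a) (coeff m p) * Polynomial.aeval (X a) (S (m a)),
    sum_mem fun m hm => mul_mem ?_ (hSmem _), ?_⟩
  · refine hmono _ fun i hi => mem_supported.mp hp ((mem_vars_iff_mem_support i).mpr ⟨m, hm, ?_⟩)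
    rw [Finsupp.support_erase] at hi
    exact Finset.mem_of_mem_erase hi
  · rw [map_sum, ← Finset.sum_sub_distrib]
    conv_rhs => rw [p.as_sum]
    refine Finset.sum_congr rfl fun m hm => ?_
    have h1 : shift R a (monomial (m.erase a) (coeff m p)) = monomial (m.erase a) (coeff m p) :=
      shift_eq_self_of_mem_supported (s := {a}ᶜ) (by simp)
        (hmono _ fun i hi => by simp_all)
    rw [map_mul, h1, hshift, ← mul_sub, add_sub_cancel_left, X_pow_eq_monomial, monomial_mul,
      mul_one, Finsupp.erase_add_single]

end MvPolynomial

theorem CategoryTheory.ShortComplex.ShortExact.subsingleton_ext_succ_of_surjective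
    {C : Type*} [Category* C] [Abelian C] [HasExt C] {S : ShortComplex C} (hS : S.ShortExact)
    (Y : C) (h₁ : ∀ n : ℕ, Subsingleton (Ext S.X₁ Y (n + 1)))
    (h₂ : ∀ n : ℕ, Subsingleton (Ext S.X₂ Y (n + 1)))
    (hf : ∀ u : S.X₁ ⟶ Y, ∃ v : S.X₂ ⟶ Y, S.f ≫ v = u) (n : ℕ) :
    Subsingleton (Ext S.X₃ Y (n + 1)) := by
  refine subsingleton_of_forall_eq 0 fun x => ?_
  obtain ⟨y, rfl⟩ := Ext.contravariant_sequence_exact₃ hS Y x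
    ((h₂ n).elim _ _) (add_comm 1 n)
  cases n with
  | succ n => rw [(h₁ n).elim y 0, Ext.comp_zero]
  | zero =>
    obtain ⟨u, rfl⟩ := Ext.addEquiv₀.symm.surjective y
    obtain ⟨v, rfl⟩ := hf u
    have : Ext.addEquiv₀.symm (S.f ≫ v) =
        (Ext.mk₀ S.f).comp (Ext.mk₀ v) (zero_add 0) := by simp
    rw [this]
    exact hS.extClass_comp_assoc _

theorem CategoryTheory.Abelian.Ext.subsingleton_of_iso
    {C : Type*} [Category* C] [Abelian C] [HasExt C] {X X' : C} (e : X ≅ X') (Y : C) (n : ℕ)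
    (h : Subsingleton (Ext X Y n)) : Subsingleton (Ext X' Y n) := by
  refine subsingleton_of_forall_eq 0 fun x => ?_
  have : x = (Ext.mk₀ e.inv).comp ((Ext.mk₀ e.hom).comp x (zero_add n)) (zero_add n) := by simp
  rw [this, h.elim ((Ext.mk₀ e.hom).comp x (zero_add n)) 0, Ext.comp_zero]

theorem groupCohomology.isZero_succ_of_subsingleton_ext {k G : Type} [CommRing k] [Group G]
    [HasExt.{0} (Rep.{0} k G)] (A : Rep.{0} k G) (n : ℕ)
    (h : Subsingleton (Ext.{0} (Rep.trivial k G k) A (n + 1))) :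
    IsZero (groupCohomology A (n + 1)) := by
  let P := Rep.barResolution k G
  refine IsZero.of_iso ?_ (groupCohomologyIso A (n + 1) P)
  rw [← HomologicalComplex.exactAt_iff_isZero_homology,
    HomologicalComplex.exactAt_iff' _ n (n + 1) (n + 2) (by simp) (by simp),
    ShortComplex.moduleCat_exact_iff]
  intro f hf
  have hf' : P.complex.d (n + 2) (n + 1) ≫ f = 0 := hf
  obtain ⟨g, hg⟩ := (P.extMk_eq_zero_iff f (n + 2) rfl hf' n rfl).mp (h.elim _ _)
  exact ⟨g, hg⟩

namespace Rep

variable {k G : Type} [CommRing k] [CommGroup G]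

theorem quotient_hom_ext {A : Rep.{0} k G} {H : Subgroup G} {u v : ofMulAction k G (G ⧸ H) ⟶ A}
    (h : u.hom (MonoidAlgebra.single ((1 : G) : G ⧸ H) 1) =
      v.hom (MonoidAlgebra.single ((1 : G) : G ⧸ H) 1)) : u = v := by
  ext x
  induction x using QuotientGroup.induction_on with
  | H g =>
    have hg : MonoidAlgebra.single (g : G ⧸ H) (1 : k) =
        (ofMulAction k G (G ⧸ H)).ρ g (MonoidAlgebra.single ((1 : G) : G ⧸ H) 1) := by
      change _ = Representation.ofMulAction k G _ g _
      rw [Representation.ofMulAction_single]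
      exact congrArg (MonoidAlgebra.single · 1)
        (congrArg (QuotientGroup.mk (s := H)) (mul_one g).symm)
    change u.hom (MonoidAlgebra.single (g : G ⧸ H) (1 : k)) =
      v.hom (MonoidAlgebra.single (g : G ⧸ H) (1 : k))
    rw [hg, hom_comm_apply, hom_comm_apply, h]

/-- The map `k[G ⧸ H] ⟶ k[G ⧸ K]` induced by an inclusion `H ≤ K` of subgroups. -/
noncomputable def quotientMap {H K : Subgroup G} (h : H ≤ K) :
    ofMulAction k G (G ⧸ H) ⟶ ofMulAction k G (G ⧸ K) :=
  ofHom ⟨(MonoidAlgebra.coeffLinearEquiv k).symm.toLinearMap ∘ₗ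
    Finsupp.lmapDomain k k (Subgroup.quotientMapOfLE h) ∘ₗ
      (MonoidAlgebra.coeffLinearEquiv k).toLinearMap, fun g => by
    ext x
    induction x using QuotientGroup.induction_on
    simp
    rfl⟩

theorem quotientMap_single {H K : Subgroup G} (h : H ≤ K) (g : G) (c : k) :
    (quotientMap h).hom (MonoidAlgebra.single (g : G ⧸ H) c) =
      MonoidAlgebra.single (g : G ⧸ K) c := by
  simp [quotientMap]

theorem quotientMap_surjective {H K : Subgroup G} (h : H ≤ K) :
    Function.Surjective (quotientMap (k := k) h).hom := by
  intro x
  induction x using MonoidAlgebra.induction_linear with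
  | zero => exact ⟨0, map_zero _⟩
  | add x y hx hy =>
    obtain ⟨x, rfl⟩ := hx
    obtain ⟨y, rfl⟩ := hy
    exact ⟨x + y, map_add _ _ _⟩
  | single a c =>
    induction a using QuotientGroup.induction_on with
    | H g => exact ⟨_, quotientMap_single h g c⟩

/-- The endomorphism `x ↦ g • x - x` of a representation of a commutative group. -/
noncomputable def applySubId (A : Rep k G) (g : G) : A ⟶ A := A.applyAsHom g - 𝟙 A

theorem applySubId_apply (A : Rep k G) (g : G) (x : A) :
    (A.applySubId g).hom x = A.ρ g x - x := rfl

theorem applySubId_injective {H : Subgroup G} {g : G} (hg : ∀ n : ℤ, g ^ n ∈ H → n = 0) :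
    Function.Injective ((ofMulAction k G (G ⧸ H)).applySubId g).hom := by
  rw [injective_iff_map_eq_zero]
  intro f hf
  rw [applySubId_apply, sub_eq_zero] at hf
  have h1 (x : G ⧸ H) : f.coeff (g • x) = f.coeff x := by
    conv_lhs => rw [← hf]
    exact Finsupp.mapDomain_apply (MulAction.injective g) f.coeff x
  have h2 (n : ℕ) (x : G ⧸ H) : f.coeff (g ^ n • x) = f.coeff x := by
    induction n with
    | zero => simp
    | succ n ih => rw [pow_succ', mul_smul, h1, ih]
  ext x
  by_contra hx
  refine Set.infinite_of_injective_forall_mem (f := fun n : ℕ => g ^ n • x)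
    (s := f.coeff.support) ?_ (fun n => ?_) f.coeff.support.finite_toSet
  · intro n m hnm
    induction x using QuotientGroup.induction_on with
    | H a =>
      have h3 : (a⁻¹ * (g ^ n)⁻¹ * (g ^ m * a)) ∈ H := by
        simpa [mul_assoc] using QuotientGroup.eq.mp hnm
      have h4 : a⁻¹ * (g ^ n)⁻¹ * (g ^ m * a) = g ^ ((m : ℤ) - n) := by
        rw [zpow_sub, zpow_natCast, zpow_natCast, mul_comm (g ^ m) a, mul_right_comm,
          ← mul_assoc, inv_mul_cancel, one_mul]
      have := hg _ (h4 ▸ h3)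
      lia
  · simpa [h2] using hx

theorem exact_applySubId_quotientMap (H : Subgroup G) (g : G)
    (x : MonoidAlgebra k (G ⧸ H))
    (hx : (quotientMap (le_sup_left : H ≤ H ⊔ Subgroup.zpowers g)).hom x = 0) :
    ∃ y, ((ofMulAction k G (G ⧸ H)).applySubId g).hom y = x := by
  let N := LinearMap.range ((ofMulAction k G (G ⧸ H)).applySubId g).hom.toLinearMap
  have hN (n : ℤ) (a : G ⧸ H) : N.mkQ (MonoidAlgebra.single (g ^ n • a) 1) =
      N.mkQ (MonoidAlgebra.single a 1) := by
    have h1 (b : G ⧸ H) : N.mkQ (MonoidAlgebra.single (g • b) 1) =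
        N.mkQ (MonoidAlgebra.single b 1) := by
      rw [← sub_eq_zero, ← map_sub, Submodule.mkQ_apply, Submodule.Quotient.mk_eq_zero]
      refine ⟨MonoidAlgebra.single b 1, ?_⟩
      change (applySubId _ g).hom _ = _
      rw [applySubId_apply]
      simp
    induction n with
    | zero => simp
    | succ n ih => rw [add_comm, zpow_add, zpow_one, mul_smul, h1, ih]
    | pred n ih => rw [← h1, ← ih, ← mul_smul, ← zpow_one_add]; simp
  let s : G ⧸ (H ⊔ Subgroup.zpowers g) → _ ⧸ N :=
    Quotient.lift (fun a : G => N.mkQ (MonoidAlgebra.single (a : G ⧸ H) 1)) fun a b hab => by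
      replace hab := QuotientGroup.leftRel_apply.mp hab
      rw [Subgroup.mem_sup] at hab
      obtain ⟨h, hh, _, ⟨n, rfl⟩, e⟩ := hab
      have : (b : G ⧸ H) = g ^ n • (a : G ⧸ H) := by
        refine (QuotientGroup.eq.mpr ?_ : ((g ^ n * a : G) : G ⧸ H) = b).symm
        have e' : (g ^ n * a)⁻¹ * b = h := by
          rw [mul_inv_rev, mul_right_comm, ← e, mul_inv_cancel_right]
        exact e' ▸ hh
      rw [this, hN]
  have hs : (Finsupp.linearCombination k s ∘ₗ (MonoidAlgebra.coeffLinearEquiv k).toLinearMap) ∘ₗ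
      (quotientMap (le_sup_left : H ≤ H ⊔ Subgroup.zpowers g)).hom.toLinearMap = N.mkQ := by
    ext a
    induction a using QuotientGroup.induction_on with
    | H a =>
      change Finsupp.linearCombination k s
        ((quotientMap _).hom (MonoidAlgebra.single (a : G ⧸ H) 1)).coeff = _
      rw [quotientMap_single, MonoidAlgebra.coeff_single, Finsupp.linearCombination_single,
        one_smul]
      rfl
  have h0 : N.mkQ x = 0 := by
    rw [← hs]
    change Finsupp.linearCombination k s ((quotientMap _).hom x).coeff = 0
    rw [hx]
    simp
  rwa [Submodule.mkQ_apply, Submodule.Quotient.mk_eq_zero] at h0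

theorem applySubId_comp_quotientMap (H : Subgroup G) (g : G) :
    (ofMulAction k G (G ⧸ H)).applySubId g ≫
      quotientMap (le_sup_left : H ≤ H ⊔ Subgroup.zpowers g) = 0 := by
  refine quotient_hom_ext ?_
  rw [comp_apply, applySubId_apply, map_sub, hom_comm_apply, quotientMap_single]
  refine sub_eq_zero.mpr ?_
  change Representation.ofMulAction k G _ g _ = _
  rw [Representation.ofMulAction_single]
  congr 1
  refine (QuotientGroup.eq.mpr ?_ : ((g * 1 : G) : G ⧸ (H ⊔ Subgroup.zpowers g)) = (1 : G))
  rw [mul_one, mul_one]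
  exact inv_mem (Subgroup.mem_sup_right (Subgroup.mem_zpowers g))

theorem shortExact_applySubId_quotientMap {H : Subgroup G} {g : G}
    (hg : ∀ n : ℤ, g ^ n ∈ H → n = 0) :
    (ShortComplex.mk ((ofMulAction k G (G ⧸ H)).applySubId g)
      (quotientMap (le_sup_left : H ≤ H ⊔ Subgroup.zpowers g))
      (applySubId_comp_quotientMap H g)).ShortExact where
  exact := by
    refine (forget₂ _ (ModuleCat k)).reflects_exact_of_faithful _ ?_
    rw [ShortComplex.moduleCat_exact_iff]
    exact exact_applySubId_quotientMap H g
  mono_f := (mono_iff_injective _).mpr (applySubId_injective hg)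
  epi_g := (epi_iff_surjective _).mpr (quotientMap_surjective _)

/-- The map `k[G ⧸ H] ⟶ A` determined by an `H`-invariant element of `A`. -/
noncomputable def quotientHom {A : Rep.{0} k G} {H : Subgroup G} (a : A)
    (ha : ∀ h ∈ H, A.ρ h a = a) : ofMulAction k G (G ⧸ H) ⟶ A :=
  ofHom ⟨Finsupp.linearCombination k (Quotient.lift (fun g => A.ρ g a) fun x y hxy => by
      replace hxy := QuotientGroup.leftRel_apply.mp hxy
      conv_lhs => rw [← ha _ hxy]
      rw [← Module.End.mul_apply, ← map_mul, mul_inv_cancel_left]) ∘ₗ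
    (MonoidAlgebra.coeffLinearEquiv k).toLinearMap, fun g => by
      ext x
      induction x using QuotientGroup.induction_on with
      | H x =>
        change Finsupp.linearCombination k _ (Representation.ofMulAction k G _ g
          (MonoidAlgebra.single (x : G ⧸ H) 1)).coeff =
            A.ρ g (Finsupp.linearCombination k _ (MonoidAlgebra.single (x : G ⧸ H) 1).coeff)
        rw [Representation.ofMulAction_single, MonoidAlgebra.coeff_single,
          MonoidAlgebra.coeff_single, Finsupp.linearCombination_single,
          Finsupp.linearCombination_single, one_smul, one_smul]
        exact congrArg (· a) (map_mul A.ρ g x)⟩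

theorem quotientHom_single_one {A : Rep.{0} k G} {H : Subgroup G} (a : A)
    (ha : ∀ h ∈ H, A.ρ h a = a) :
    (quotientHom a ha).hom (MonoidAlgebra.single ((1 : G) : G ⧸ H) 1) = a := by
  change Finsupp.linearCombination k _ (MonoidAlgebra.single _ _).coeff = a
  rw [MonoidAlgebra.coeff_single, Finsupp.linearCombination_single, one_smul]
  exact (congrArg (· a) (map_one A.ρ))

theorem exists_applySubId_comp_eq {A : Rep.{0} k G} {H : Subgroup G} {g : G}
    (hA : ∀ a : A, (∀ h ∈ H, A.ρ h a = a) → ∃ b : A, (∀ h ∈ H, A.ρ h b = b) ∧ A.ρ g b - b = a)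
    (u : ofMulAction k G (G ⧸ H) ⟶ A) :
    ∃ v : ofMulAction k G (G ⧸ H) ⟶ A, (ofMulAction k G (G ⧸ H)).applySubId g ≫ v = u := by
  obtain ⟨b, hb, hba⟩ := hA (u.hom (MonoidAlgebra.single ((1 : G) : G ⧸ H) 1)) fun h hh => by
    rw [← hom_comm_apply]
    change u.hom (Representation.ofMulAction k G _ h _) = _
    rw [Representation.ofMulAction_single]
    refine congrArg (fun y => u.hom (MonoidAlgebra.single y 1))
      (QuotientGroup.eq.mpr ?_ : ((h * 1 : G) : G ⧸ H) = (1 : G))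
    simpa using hh
  refine ⟨quotientHom b hb, quotient_hom_ext ?_⟩
  rw [← hba, comp_apply, applySubId_apply, map_sub, hom_comm_apply, quotientHom_single_one]

instance projective_ofMulAction_quotient_bot :
    Projective (ofMulAction k G (G ⧸ (⊥ : Subgroup G))) where
  factors f e _ := by
    obtain ⟨a, ha⟩ := (epi_iff_surjective e).mp inferInstance
      (f.hom (MonoidAlgebra.single ((1 : G) : G ⧸ (⊥ : Subgroup G)) 1))
    refine ⟨quotientHom a fun h hh => ?_, quotient_hom_ext ?_⟩
    · rw [Subgroup.mem_bot.mp hh, map_one, Module.End.one_apply]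
    · rw [comp_apply, quotientHom_single_one, ha]

theorem subsingleton_ext_ofMulAction_quotient_sup_zpowers [HasExt.{0} (Rep.{0} k G)]
    {A : Rep.{0} k G} {H : Subgroup G} {g : G} (hg : ∀ n : ℤ, g ^ n ∈ H → n = 0)
    (hA : ∀ a : A, (∀ h ∈ H, A.ρ h a = a) → ∃ b : A, (∀ h ∈ H, A.ρ h b = b) ∧ A.ρ g b - b = a)
    (h : ∀ n : ℕ, Subsingleton (Ext (ofMulAction k G (G ⧸ H)) A (n + 1))) (n : ℕ) :
    Subsingleton (Ext (ofMulAction k G (G ⧸ (H ⊔ Subgroup.zpowers g))) A (n + 1)) :=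
  (shortExact_applySubId_quotientMap hg).subsingleton_ext_succ_of_surjective A h h
    (exists_applySubId_comp_eq hA) n

end Rep

section IntegerLattice

variable {r : ℕ}

/-- The `j`-th standard generator of `ℤ^r`, written multiplicatively. -/
abbrev latticeGenerator (j : Fin r) : Multiplicative (Fin r → ℤ) :=
  Multiplicative.ofAdd (Pi.single j 1)

/-- The subgroup of `ℤ^r` generated by the standard generators with index in `s`. -/
def coordinateSubgroup (s : Set (Fin r)) : Subgroup (Multiplicative (Fin r → ℤ)) :=
  Subgroup.closure (latticeGenerator '' s)

theorem coordinateSubgroup_empty : coordinateSubgroup (∅ : Set (Fin r)) = ⊥ := by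
  rw [coordinateSubgroup, Set.image_empty, Subgroup.closure_empty]

theorem coordinateSubgroup_insert (a : Fin r) (s : Set (Fin r)) :
    coordinateSubgroup (insert a s) =
      coordinateSubgroup s ⊔ Subgroup.zpowers (latticeGenerator a) := by
  rw [coordinateSubgroup, Set.image_insert_eq, Set.insert_eq, Subgroup.closure_union, sup_comm,
    ← Subgroup.zpowers_eq_closure, coordinateSubgroup]

theorem coordinateSubgroup_univ : coordinateSubgroup (Set.univ : Set (Fin r)) = ⊤ := by
  rw [eq_top_iff]
  intro v _
  have hv : v = ∏ j, latticeGenerator j ^ (v.toAdd j) := by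
    apply Multiplicative.toAdd.injective
    rw [toAdd_prod]
    funext i
    simp [Finset.sum_apply, Pi.single_apply]
  rw [hv]
  exact Subgroup.prod_mem _ fun j _ => Subgroup.zpow_mem _
    (Subgroup.subset_closure (Set.mem_image_of_mem _ (Set.mem_univ j))) _

theorem eq_zero_of_latticeGenerator_zpow_mem {a : Fin r} {s : Set (Fin r)} (ha : a ∉ s) (n : ℤ)
    (hn : latticeGenerator a ^ n ∈ coordinateSubgroup s) : n = 0 := by
  have hle : coordinateSubgroup s ≤
      (AddMonoidHom.toMultiplicative (Pi.evalAddMonoidHom (fun _ : Fin r => ℤ) a)).ker := by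
    rw [coordinateSubgroup, Subgroup.closure_le]
    rintro _ ⟨j, hj, rfl⟩
    have : a ≠ j := fun h => ha (h ▸ hj)
    simp [this]
  simpa [MonoidHom.mem_ker] using hle hn

theorem Representation.forall_mem_closure_apply_eq_iff {k G V : Type*} [CommSemiring k] [Group G]
    [AddCommMonoid V] [Module k V] (ρ : Representation k G V) (S : Set G) (v : V) :
    (∀ g ∈ Subgroup.closure S, ρ g v = v) ↔ ∀ g ∈ S, ρ g v = v := by
  refine ⟨fun h g hg => h g (Subgroup.subset_closure hg), fun h g hg => ?_⟩
  induction hg using Subgroup.closure_induction with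
  | mem g hg => exact h g hg
  | one => simp
  | mul x y _ _ hx hy => rw [map_mul, Module.End.mul_apply, hy, hx]
  | inv x _ hx =>
    conv_lhs => rw [← hx]
    simp

theorem forall_mem_coordinateSubgroup_apply_eq_iff {R : Type} [CommRing R] [Algebra ℚ R]
    (ρ : Representation R (Multiplicative (Fin r → ℤ)) (MvPolynomial (Fin r) R))
    (hρ : ∀ j, ρ (latticeGenerator j) = (shift R j).toLinearMap) (s : Set (Fin r))
    (p : MvPolynomial (Fin r) R) :
    (∀ g ∈ coordinateSubgroup s, ρ g p = p) ↔ p ∈ supported R sᶜ := by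
  rw [coordinateSubgroup, ρ.forall_mem_closure_apply_eq_iff, Set.forall_mem_image,
    mem_supported_compl_iff_shift_eq_self]
  simp [hρ]

theorem subsingleton_ext_ofMulAction_quotient_coordinateSubgroup {R : Type} [CommRing R]
    [Algebra ℚ R] [HasExt.{0} (Rep.{0} R (Multiplicative (Fin r → ℤ)))]
    (ρ : Representation R (Multiplicative (Fin r → ℤ)) (MvPolynomial (Fin r) R))
    (hρ : ∀ j, ρ (latticeGenerator j) = (shift R j).toLinearMap) (s : Finset (Fin r)) (n : ℕ) :
    Subsingleton (Ext (Rep.ofMulAction R (Multiplicative (Fin r → ℤ))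
      (Multiplicative (Fin r → ℤ) ⧸ coordinateSubgroup (s : Set (Fin r)))) (Rep.of ρ) (n + 1)) := by
  induction s using Finset.induction_on generalizing n with
  | empty =>
    rw [Finset.coe_empty, coordinateSubgroup_empty]
    exact Ext.subsingleton_of_projective _ _ n
  | insert a s ha ih =>
    rw [Finset.coe_insert, coordinateSubgroup_insert]
    refine Rep.subsingleton_ext_ofMulAction_quotient_sup_zpowers
      (eq_zero_of_latticeGenerator_zpow_mem (by simpa using ha)) (fun p hp => ?_) ih n
    obtain ⟨q, hq, hqp⟩ := exists_shift_sub_self_eq (a := a) (by simpa using ha)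
      ((forall_mem_coordinateSubgroup_apply_eq_iff ρ hρ _ _).mp hp)
    refine ⟨q, (forall_mem_coordinateSubgroup_apply_eq_iff ρ hρ _ _).mpr hq, ?_⟩
    rw [← hqp]
    change ρ _ q - q = _
    rw [hρ]
    rfl

end IntegerLattice

/-- Let `R` be a commutative `ℚ`-algebra and let `ℤ^r` act `R`-linearly on
`R[T₁,…,T_r]`, the `j`-th standard generator acting by `T_j ↦ T_j + 1`, `T_i ↦ T_i`
(`i ≠ j`). Then the invariants of this representation are exactly the constants `R`,
and the group cohomology `H^m(ℤ^r, R[T₁,…,T_r])` vanishes for all `m ≥ 1`. -/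
theorem invariants_and_groupCohomology_of_translation_action_on_polynomials
    (R : Type) [CommRing R] [Algebra ℚ R] (r : ℕ)
    (ρ : Representation R (Multiplicative (Fin r → ℤ)) (MvPolynomial (Fin r) R))
    (hρ : ∀ j : Fin r,
      ρ (Multiplicative.ofAdd (Pi.single j (1 : ℤ)))
        = (aeval (fun i : Fin r =>
            (X i + if i = j then 1 else 0 : MvPolynomial (Fin r) R))).toLinearMap) :
    (∀ p : MvPolynomial (Fin r) R, p ∈ ρ.invariants ↔ ∃ c : R, p = C c) ∧
    (∀ m : ℕ, 1 ≤ m → CategoryTheory.Limits.IsZero (groupCohomology (Rep.of ρ) m)) := by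
  have hρ' : ∀ j, ρ (latticeGenerator j) = (shift R j).toLinearMap := hρ
  refine ⟨fun p => ?_, fun m hm => ?_⟩
  · have h := forall_mem_coordinateSubgroup_apply_eq_iff ρ hρ' Set.univ p
    rw [coordinateSubgroup_univ, Set.compl_univ, supported_empty, Algebra.mem_bot] at h
    rw [Representation.mem_invariants]
    simpa [eq_comm] using h
  · obtain ⟨n, rfl⟩ := Nat.exists_eq_add_of_le' hm
    have := hasExt_of_enoughProjectives.{0} (Rep.{0} R (Multiplicative (Fin r → ℤ)))
    refine groupCohomology.isZero_succ_of_subsingleton_ext _ n ?_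
    have h := subsingleton_ext_ofMulAction_quotient_coordinateSubgroup ρ hρ' Finset.univ n
    rw [Finset.coe_univ, coordinateSubgroup_univ] at h
    have := QuotientGroup.subsingleton_quotient_top (G := Multiplicative (Fin r → ℤ))
    exact Ext.subsingleton_of_iso (Rep.ofMulActionSubsingletonIsoTrivial R _ _) _ _ h
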